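/- arXiv:gr-qc/0008019 — 9 statements merged into one kernel-verified Lean document; each statement's English description precedes it below -/
import Mathlib

section
/- Let l ≥ 1 be an integer, R > 0, and f : (0,R) → ℝ be differentiable with f(r) > 0 for all r ∈ (0,R). If U : (0,R) → ℝ is differentiable and satisfies 2·(f·U)'(r) + (l/r²)·(r²·f)'(r)·U(r) = 0 for all r ∈ (0,R), then the function r ↦ r^l · f(r)^{(l+2)/2} · U(r) is constant on (0,R); equivalently U(r) = K · f(r)^{−(l+2)/2} · r^{−l} for some constant K. Consequently, if f extends continuously to [0,R) with f(0) > 0 and U is bounded on some interval (0,δ) with δ > 0, then U ≡ 0 on (0,R). -/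
open Set Filter Topology in
/-- A solution of the axial-led equation has constant `r ^ l * f r ^ ((l + 2) / 2) * U r`. -/
theorem exists_const_rpow_mul_rpow_mul (l R : ℝ) (f U : ℝ → ℝ)
    (hf : ∀ r ∈ Ioo (0 : ℝ) R, DifferentiableAt ℝ f r)
    (hfpos : ∀ r ∈ Ioo (0 : ℝ) R, 0 < f r)
    (hU : ∀ r ∈ Ioo (0 : ℝ) R, DifferentiableAt ℝ U r)
    (hode : ∀ r ∈ Ioo (0 : ℝ) R,
      2 * deriv (fun s => f s * U s) r
        + (l / r ^ 2) * deriv (fun s => s ^ 2 * f s) r * U r = 0) :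
    ∃ K : ℝ, ∀ r ∈ Ioo (0 : ℝ) R, r ^ l * f r ^ ((l + 2) / 2) * U r = K := by
  have hderiv : ∀ r ∈ Ioo (0 : ℝ) R,
      HasDerivAt (fun s => s ^ l * f s ^ ((l + 2) / 2) * U s) 0 r := by
    intro r hr
    have hr0 : 0 < r := hr.1
    have hfr : 0 < f r := hfpos r hr
    have hdf := (hf r hr).hasDerivAt
    have hdU := (hU r hr).hasDerivAt
    have ode := hode r hr
    have hfU : HasDerivAt (fun s => f s * U s) _ r := hdf.mul hdU
    have hsqf : HasDerivAt (fun s => s ^ 2 * f s) _ r := (hasDerivAt_pow 2 r).mul hdf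
    rw [hfU.deriv, hsqf.deriv] at ode
    have hprod := ((Real.hasDerivAt_rpow_const (p := l) (Or.inl hr0.ne')).mul
      (hdf.rpow_const (p := (l + 2) / 2) (Or.inl hfr.ne'))).mul hdU
    refine hprod.congr_deriv ?_
    simp only [Pi.mul_apply]
    rw [Real.rpow_sub_one hr0.ne', Real.rpow_sub_one hfr.ne']
    field_simp at ode ⊢
    push_cast at ode
    have hred : 2 * (deriv f r * U r + f r * deriv U r) * r
        + U r * l * (f r * 2 + deriv f r * r) = 0 :=
      mul_left_cancel₀ hr0.ne' (by linear_combination ode)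
    linear_combination (r ^ l * f r ^ ((l + 2) / 2)) * hred
  rcases le_or_gt R 0 with hR | hR
  · exact ⟨0, fun r hr => absurd (hr.1.trans hr.2) hR.not_gt⟩
  · obtain ⟨K, hK⟩ := isOpen_Ioo.exists_is_const_of_deriv_eq_zero isPreconnected_Ioo
      (fun r hr => (hderiv r hr).differentiableAt.differentiableWithinAt)
      (fun r hr => (hderiv r hr).deriv)
    exact ⟨K, hK⟩

open Set Filter Topology in
/-- If `U` is bounded near `0` and `f` is continuous there with nonzero value, then
`r ^ l * f r ^ a * U r` tends to `0`. -/
theorem tendsto_rpow_mul_rpow_mul_nhdsGT_zero {l : ℝ} (a : ℝ) (hl : 0 < l) {f U : ℝ → ℝ}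
    (hf : ContinuousWithinAt f (Ioi 0) 0) (hf0 : f 0 ≠ 0) {δ C : ℝ} (hδ : 0 < δ)
    (hC : ∀ r ∈ Ioo (0 : ℝ) δ, |U r| ≤ C) :
    Tendsto (fun r => r ^ l * f r ^ a * U r) (𝓝[>] 0) (𝓝 0) := by
  have hpow : Tendsto (fun r : ℝ => r ^ l) (𝓝[>] 0) (𝓝 0) := by
    have h := (Real.continuousAt_rpow_const 0 l (Or.inr hl.le)).tendsto
    rw [Real.zero_rpow hl.ne'] at h
    exact h.mono_left nhdsWithin_le_nhds
  have hlim : Tendsto (fun r => r ^ l * f r ^ a) (𝓝[>] 0) (𝓝 0) := by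
    simpa using hpow.mul (hf.tendsto.rpow_const (p := a) (Or.inl hf0))
  refine hlim.zero_mul_isBoundedUnder_le (isBoundedUnder_of_eventually_le (a := C) ?_)
  filter_upwards [Ioo_mem_nhdsGT hδ] with r hr using hC r hr


/-- If `U` satisfies `2·(f·U)'(r) + (l/r²)·(r²·f)'(r)·U(r) = 0` on `(0,R)`
with `f` differentiable and positive, then `r ↦ r^l · f(r)^{(l+2)/2} · U(r)` is constant
on `(0,R)` (equivalently `U(r) = K · f(r)^{-(l+2)/2} · r^{-l}`); consequently, if `f`
extends continuously to `[0,R)` with `f 0 > 0` and `U` is bounded on some `(0,δ)`,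
then `U ≡ 0` on `(0,R)`. -/
theorem axial_led_ode_forces_singular_solution
    (l : ℕ) (hl : 1 ≤ l) (R : ℝ) (hR : 0 < R)
    (f U : ℝ → ℝ)
    (hf : ∀ r ∈ Set.Ioo (0:ℝ) R, DifferentiableAt ℝ f r)
    (hfpos : ∀ r ∈ Set.Ioo (0:ℝ) R, 0 < f r)
    (hU : ∀ r ∈ Set.Ioo (0:ℝ) R, DifferentiableAt ℝ U r)
    (hode : ∀ r ∈ Set.Ioo (0:ℝ) R,
      2 * deriv (fun s => f s * U s) r
        + ((l : ℝ) / r ^ 2) * deriv (fun s => s ^ 2 * f s) r * U r = 0) :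
    (∃ K : ℝ, ∀ r ∈ Set.Ioo (0:ℝ) R,
      r ^ (l : ℝ) * (f r) ^ (((l : ℝ) + 2) / 2) * U r = K ∧
      U r = K * (f r) ^ (-(((l : ℝ) + 2) / 2)) * r ^ (-(l : ℝ))) ∧
    ((ContinuousOn f (Set.Ico 0 R) ∧ 0 < f 0 ∧
        ∃ δ > (0:ℝ), ∃ C : ℝ, ∀ r ∈ Set.Ioo (0:ℝ) δ, |U r| ≤ C) →
      ∀ r ∈ Set.Ioo (0:ℝ) R, U r = 0) := by
  have hl0 : (0 : ℝ) < l := by exact_mod_cast hl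
  obtain ⟨K, hK⟩ := exists_const_rpow_mul_rpow_mul l R f U hf hfpos hU hode
  have hsol : ∀ r ∈ Set.Ioo (0 : ℝ) R,
      U r = K * (f r) ^ (-(((l : ℝ) + 2) / 2)) * r ^ (-(l : ℝ)) := by
    intro r hr
    have hrl := Real.rpow_pos_of_pos hr.1 (l : ℝ)
    have hfa := Real.rpow_pos_of_pos (hfpos r hr) (((l : ℝ) + 2) / 2)
    rw [← hK r hr, Real.rpow_neg hr.1.le, Real.rpow_neg (hfpos r hr).le]
    generalize r ^ (l : ℝ) = x at *
    generalize f r ^ (((l : ℝ) + 2) / 2) = y at *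
    field_simp
  refine ⟨⟨K, fun r hr => ⟨hK r hr, hsol r hr⟩⟩, ?_⟩
  rintro ⟨hcont, hf0, δ, hδ, C, hC⟩ r hr
  have hfc : ContinuousWithinAt f (Set.Ioi 0) 0 :=
    (hcont 0 ⟨le_rfl, hR⟩).mono_of_mem_nhdsWithin
      (Filter.mem_of_superset (Ioo_mem_nhdsGT hR) Set.Ioo_subset_Ico_self)
  have hlim := tendsto_rpow_mul_rpow_mul_nhdsGT_zero (((l : ℝ) + 2) / 2) hl0 hfc hf0.ne' hδ hC
  have hK0 : K = 0 := by
    refine tendsto_nhds_unique (tendsto_const_nhds.congr' ?_) hlim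
    filter_upwards [Ioo_mem_nhdsGT hR] with s hs using (hK s hs).symm
  rw [hsol r hr, hK0, zero_mul, zero_mul]
end

section
/- Let l ≥ 1 be an integer, R > 0, and let f, g : (0,R) → ℝ be differentiable with f(r) > 0 and g(r) > 0 for all r ∈ (0,R). If W : (0,R) → ℝ is differentiable and satisfies (l/r)·(r²·f)'(r)·W(r) + 2·(f(r)/g(r))·(d/dr)(g(r)·r·W(r)) = 0 for all r ∈ (0,R), then the function r ↦ (r²·f(r))^{l/2} · g(r) · r · W(r) is constant on (0,R); equivalently W(r) = K · f(r)^{−l/2} · g(r)^{−1} · r^{−(l+1)} for some constant K. Consequently, if f and g extend continuously to [0,R) with f(0) > 0 and g(0) > 0, and W is bounded on some interval (0,δ) with δ > 0, then W ≡ 0 on (0,R). -/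
/-- If `a * deriv P * G + P * deriv G = 0` with `P > 0` on an open interval, then `P ^ a * G`
is constant there. -/
theorem exists_rpow_mul_eq_const_of_ode {a u v : ℝ} {P G : ℝ → ℝ}
    (hP : ∀ r ∈ Set.Ioo u v, DifferentiableAt ℝ P r)
    (hG : ∀ r ∈ Set.Ioo u v, DifferentiableAt ℝ G r)
    (hpos : ∀ r ∈ Set.Ioo u v, 0 < P r)
    (hode : ∀ r ∈ Set.Ioo u v, a * deriv P r * G r + P r * deriv G r = 0) :
    ∃ K : ℝ, ∀ r ∈ Set.Ioo u v, P r ^ a * G r = K := by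
  have hderiv : ∀ r ∈ Set.Ioo u v, HasDerivAt (fun s => P s ^ a * G s) 0 r := by
    intro r hr
    refine (((hP r hr).hasDerivAt.rpow_const (p := a) (Or.inl (hpos r hr).ne')).mul
      (hG r hr).hasDerivAt).congr_deriv ?_
    have hpow : P r ^ a = P r ^ (a - 1) * P r := by
      rw [← Real.rpow_add_one (hpos r hr).ne', sub_add_cancel]
    rw [hpow]
    linear_combination P r ^ (a - 1) * hode r hr
  exact isOpen_Ioo.exists_is_const_of_deriv_eq_zero isPreconnected_Ioo
    (fun r hr => (hderiv r hr).differentiableAt.differentiableWithinAt)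
    (fun r hr => (hderiv r hr).deriv)

open Filter Topology in
/-- If `f` and `g` have right limits at `0` and `W` is bounded near `0`, then
`(r ^ 2 * f r) ^ a * g r * r * W r` tends to `0` as `r` decreases to `0`. -/
theorem tendsto_rpow_mul_nhdsGT_zero {a A B C : ℝ} {f g W : ℝ → ℝ} (ha : 0 ≤ a)
    (hf : Tendsto f (𝓝[>] 0) (𝓝 A)) (hg : Tendsto g (𝓝[>] 0) (𝓝 B))
    (hW : ∀ᶠ r in 𝓝[>] (0 : ℝ), |W r| ≤ C) :
    Tendsto (fun r => (r ^ 2 * f r) ^ a * g r * r * W r) (𝓝[>] 0) (𝓝 0) := by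
  have hid : Tendsto (fun r : ℝ => r) (𝓝[>] 0) (𝓝 0) := nhdsWithin_le_nhds
  have h := ((((hid.pow 2).mul hf).rpow_const (Or.inr ha)).mul hg).mul hid
  rw [mul_zero] at h
  exact h.zero_mul_isBoundedUnder_le ⟨C, by simpa using hW⟩

/-- If `W` satisfies `(l/r)·(r²·f)'(r)·W(r) + 2·(f/g)(r)·(g·r·W)'(r) = 0`
on `(0,R)` with `f, g` differentiable and positive, then
`r ↦ (r²·f(r))^{l/2} · g(r) · r · W(r)` is constant on `(0,R)` (equivalently
`W(r) = K · f(r)^{-l/2} · g(r)⁻¹ · r^{-(l+1)}`); consequently, if `f` and `g` extend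
continuously to `[0,R)` with `f 0 > 0` and `g 0 > 0`, and `W` is bounded on some
`(0,δ)`, then `W ≡ 0` on `(0,R)`. -/
theorem polar_led_ode_forces_singular_solution
    (l : ℕ) (hl : 1 ≤ l) (R : ℝ) (hR : 0 < R)
    (f g W : ℝ → ℝ)
    (hf : ∀ r ∈ Set.Ioo (0:ℝ) R, DifferentiableAt ℝ f r)
    (hg : ∀ r ∈ Set.Ioo (0:ℝ) R, DifferentiableAt ℝ g r)
    (hfpos : ∀ r ∈ Set.Ioo (0:ℝ) R, 0 < f r)
    (hgpos : ∀ r ∈ Set.Ioo (0:ℝ) R, 0 < g r)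
    (hW : ∀ r ∈ Set.Ioo (0:ℝ) R, DifferentiableAt ℝ W r)
    (hode : ∀ r ∈ Set.Ioo (0:ℝ) R,
      ((l : ℝ) / r) * deriv (fun s => s ^ 2 * f s) r * W r
        + 2 * (f r / g r) * deriv (fun s => g s * s * W s) r = 0) :
    (∃ K : ℝ, ∀ r ∈ Set.Ioo (0:ℝ) R,
      (r ^ 2 * f r) ^ ((l : ℝ) / 2) * g r * r * W r = K ∧
      W r = K * (f r) ^ (-((l : ℝ) / 2)) * (g r)⁻¹ * r ^ (-((l : ℝ) + 1))) ∧
    ((ContinuousOn f (Set.Ico 0 R) ∧ ContinuousOn g (Set.Ico 0 R) ∧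
        0 < f 0 ∧ 0 < g 0 ∧
        ∃ δ > (0:ℝ), ∃ C : ℝ, ∀ r ∈ Set.Ioo (0:ℝ) δ, |W r| ≤ C) →
      ∀ r ∈ Set.Ioo (0:ℝ) R, W r = 0) := by
  have hPd : ∀ r ∈ Set.Ioo (0:ℝ) R, DifferentiableAt ℝ (fun s => s ^ 2 * f s) r :=
    fun r hr => (differentiableAt_id.pow 2).mul (hf r hr)
  have hGd : ∀ r ∈ Set.Ioo (0:ℝ) R, DifferentiableAt ℝ (fun s => g s * s * W s) r :=
    fun r hr => ((hg r hr).mul differentiableAt_id).mul (hW r hr)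
  have hPpos : ∀ r ∈ Set.Ioo (0:ℝ) R, 0 < r ^ 2 * f r :=
    fun r hr => mul_pos (pow_pos hr.1 2) (hfpos r hr)
  obtain ⟨K, hK⟩ := exists_rpow_mul_eq_const_of_ode (a := (l : ℝ) / 2) hPd hGd hPpos (by
    intro r hr
    have h := hode r hr
    have hr0 := hr.1.ne'
    have hg0 := (hgpos r hr).ne'
    field_simp at h
    linear_combination (r / 2) * h)
  have hconst : ∀ r ∈ Set.Ioo (0:ℝ) R, (r ^ 2 * f r) ^ ((l : ℝ) / 2) * g r * r * W r = K :=
    fun r hr => by rw [← hK r hr]; ring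
  have hsol : ∀ r ∈ Set.Ioo (0:ℝ) R,
      W r = K * (f r) ^ (-((l : ℝ) / 2)) * (g r)⁻¹ * r ^ (-((l : ℝ) + 1)) := by
    intro r hr
    have hr0 := hr.1
    have hf0 := hfpos r hr
    have hg0 := hgpos r hr
    have hpow : (r ^ 2) ^ ((l : ℝ) / 2) = r ^ (l : ℝ) := by
      rw [← Real.rpow_natCast_mul hr0.le]
      congr 1
      push_cast
      ring
    rw [← hconst r hr, Real.mul_rpow (sq_nonneg r) hf0.le, hpow, Real.rpow_neg hf0.le,
      Real.rpow_neg hr0.le, Real.rpow_add_one hr0.ne']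
    have h1 := (Real.rpow_pos_of_pos hf0 ((l : ℝ) / 2)).ne'
    have h2 := (Real.rpow_pos_of_pos hr0 (l : ℝ)).ne'
    field_simp
  refine ⟨⟨K, fun r hr => ⟨hconst r hr, hsol r hr⟩⟩, ?_⟩
  rintro ⟨hfc, hgc, -, -, δ, hδ, C, hC⟩ r hr
  have hright : ∀ φ : ℝ → ℝ, ContinuousOn φ (Set.Ico 0 R) →
      Filter.Tendsto φ (nhdsWithin 0 (Set.Ioi 0)) (nhds (φ 0)) := fun φ hφ =>
    ((continuousWithinAt_Ico_iff_Ici hR).1 (hφ 0 ⟨le_rfl, hR⟩)).mono Set.Ioi_subset_Ici_self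
  have hlim := tendsto_rpow_mul_nhdsGT_zero (a := (l : ℝ) / 2) (by positivity)
    (hright f hfc) (hright g hgc)
    (Filter.eventually_of_mem (Ioo_mem_nhdsGT hδ) hC)
  have hK0 : K = 0 := tendsto_nhds_unique (tendsto_const_nhds.congr'
    (Filter.eventually_of_mem (Ioo_mem_nhdsGT hR) fun s hs => (hconst s hs).symm)) hlim
  rw [hsol r hr, hK0]
  simp
end

section
/- Let l ≥ 1 be an integer, R > 0, and f : (0,R) → ℝ be differentiable with f(r) > 0 for all r ∈ (0,R). If U : (0,R) → ℝ is differentiable and satisfies −2·(f·U)'(r) + ((l+1)/r²)·(r²·f)'(r)·U(r) = 0 for all r ∈ (0,R), then the function r ↦ r^{−(l+1)} · f(r)^{−(l−1)/2} · U(r) is constant on (0,R); equivalently U(r) = K · r^{l+1} · f(r)^{(l−1)/2} for some constant K, which in particular remains bounded near r = 0 whenever f extends continuously to r = 0. -/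
/-- If `U` satisfies `-2·(f·U)'(r) + ((l+1)/r²)·(r²·f)'(r)·U(r) = 0`
on `(0,R)` with `f` differentiable and positive, then
`r ↦ r^{-(l+1)} · f(r)^{-(l-1)/2} · U(r)` is constant on `(0,R)` (equivalently
`U(r) = K · r^{l+1} · f(r)^{(l-1)/2}`), which in particular remains bounded near
`r = 0` whenever `f` extends continuously to `r = 0`. -/
theorem r_mode_axial_ode_regular_solution
    (l : ℕ) (hl : 1 ≤ l) (R : ℝ) (hR : 0 < R)
    (f U : ℝ → ℝ)
    (hf : ∀ r ∈ Set.Ioo (0:ℝ) R, DifferentiableAt ℝ f r)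
    (hfpos : ∀ r ∈ Set.Ioo (0:ℝ) R, 0 < f r)
    (hU : ∀ r ∈ Set.Ioo (0:ℝ) R, DifferentiableAt ℝ U r)
    (hode : ∀ r ∈ Set.Ioo (0:ℝ) R,
      -2 * deriv (fun s => f s * U s) r
        + (((l : ℝ) + 1) / r ^ 2) * deriv (fun s => s ^ 2 * f s) r * U r = 0) :
    (∃ K : ℝ, ∀ r ∈ Set.Ioo (0:ℝ) R,
      r ^ (-((l : ℝ) + 1)) * (f r) ^ (-(((l : ℝ) - 1) / 2)) * U r = K ∧
      U r = K * r ^ ((l : ℝ) + 1) * (f r) ^ (((l : ℝ) - 1) / 2)) ∧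
    (ContinuousOn f (Set.Ico 0 R) →
      ∃ δ > (0:ℝ), ∃ C : ℝ, ∀ r ∈ Set.Ioo (0:ℝ) (min δ R), |U r| ≤ C) := by
  set a : ℝ := (l : ℝ) + 1 with ha
  set b : ℝ := ((l : ℝ) - 1) / 2 with hb
  have ha0 : 0 ≤ a := by positivity
  have hb0 : 0 ≤ b := by
    have : (1 : ℝ) ≤ l := by exact_mod_cast hl
    rw [hb]
    linarith
  have hderiv : ∀ r ∈ Set.Ioo (0 : ℝ) R,
      HasDerivAt (fun s => s ^ (-a) * f s ^ (-b) * U s) 0 r := by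
    intro r hr
    have hr0 : r ≠ 0 := hr.1.ne'
    have hf0 : f r ≠ 0 := (hfpos r hr).ne'
    have hfd := (hf r hr).hasDerivAt
    have hUd := (hU r hr).hasDerivAt
    have hfU : deriv (fun s => f s * U s) r = deriv f r * U r + f r * deriv U r :=
      (hfd.mul hUd).deriv
    have hrf : deriv (fun s => s ^ 2 * f s) r = 2 * r * f r + r ^ 2 * deriv f r := by
      refine ((hasDerivAt_pow 2 r).mul hfd).deriv.trans ?_
      simp
    have hode_r := hode r hr
    rw [hfU, hrf] at hode_r
    have hlog : r * f r * deriv U r = (a * f r + b * r * deriv f r) * U r := by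
      have hl_eq : (l : ℝ) = a - 1 := by rw [ha]; ring
      have hb_eq : b = (a - 2) / 2 := by rw [hb, ha]; ring
      rw [hb_eq]
      field_simp at hode_r
      linear_combination (-1 / 2) * hode_r
    have hprod := ((Real.hasDerivAt_rpow_const (p := -a) (Or.inl hr0)).mul
      (hfd.rpow_const (p := -b) (Or.inl hf0))).mul hUd
    refine hprod.congr_deriv ?_
    simp only [Pi.mul_apply]
    rw [Real.rpow_sub_one hr0, Real.rpow_sub_one hf0]
    field_simp
    linear_combination r ^ (-a) * f r ^ (-b) * hlog
  obtain ⟨K, hK⟩ := isOpen_Ioo.exists_is_const_of_deriv_eq_zero isPreconnected_Ioo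
    (fun r hr => (hderiv r hr).differentiableAt.differentiableWithinAt)
    (fun r hr => (hderiv r hr).deriv)
  have hsol : ∀ r ∈ Set.Ioo (0 : ℝ) R, U r = K * r ^ a * f r ^ b := by
    intro r hr
    have hra := (Real.rpow_pos_of_pos hr.1 a).ne'
    have hfb := (Real.rpow_pos_of_pos (hfpos r hr) b).ne'
    rw [← hK r hr, Real.rpow_neg hr.1.le, Real.rpow_neg (hfpos r hr).le]
    field_simp
  refine ⟨⟨K, fun r hr => ⟨hK r hr, hsol r hr⟩⟩, fun hfc => ?_⟩
  have hcont : ContinuousOn (fun r => K * r ^ a * f r ^ b) (Set.Icc 0 (R / 2)) :=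
    (continuousOn_const.mul (continuousOn_id.rpow_const fun _ _ => Or.inr ha0)).mul
      ((hfc.mono (Set.Icc_subset_Ico_right (half_lt_self hR))).rpow_const
        fun _ _ => Or.inr hb0)
  obtain ⟨C, hC⟩ := isCompact_Icc.exists_bound_of_continuousOn hcont
  refine ⟨R / 2, half_pos hR, C, fun r hr => ?_⟩
  have hr' := lt_min_iff.mp hr.2
  rw [hsol r ⟨hr.1, hr'.2⟩]
  exact hC r ⟨hr.1.le, hr'.1.le⟩
end

section
/- Let l ≥ 2 be an integer, R > 0 and M₀ ∈ (0, R/2), and set β = 2M₀/R. Define coefficients by ĥ₀ = 1 and ĥ_s = β·(l+s−2)(l+s+1)/(s(2l+s+1))·ĥ_{s−1} for s ≥ 1. Then for every r > 2M₀ the series h(r) = Σ_{s=0}^∞ ĥ_s (R/r)^{l+s} converges absolutely, the resulting function h is twice differentiable on (2M₀, ∞), satisfies h(r) → 0 as r → ∞, and satisfies the vacuum axial perturbation equation (1 − 2M₀/r)·h''(r) − (l(l+1)/r² − 4M₀/r³)·h(r) = 0 for all r > 2M₀. -/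
open Filter Topology in
/-- Ratio test for the series `∑ (l+s)^k c_s x^(l+s)`, when `c` satisfies the axial recursion with
parameter `β` and `β x < 1`. -/
lemma summable_axial_moments {l : ℕ} (hl : 2 ≤ l) {β : ℝ} {c : ℕ → ℝ} (hc : ∀ s, 0 < c s)
    (hrec : ∀ s : ℕ, c (s + 1) =
      β * (((l : ℝ) + s - 1) * (l + s + 2)) / ((s + 1) * (2 * l + s + 2)) * c s)
    (k : ℕ) {x : ℝ} (hx : 0 < x) (hβx : β * x < 1) :
    Summable fun s : ℕ => ((l : ℝ) + s) ^ k * (c s * x ^ (l + s)) := by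
  have hl' : (2 : ℝ) ≤ l := by exact_mod_cast hl
  have hpos : ∀ s : ℕ, 0 < ((l : ℝ) + s) ^ k * (c s * x ^ (l + s)) := fun s => by
    have := hc s
    positivity
  have hlim : Tendsto (fun s : ℕ => (((l : ℝ) + 1 + 1 * s) / (l + 1 * s)) ^ k *
      ((β * x) * ((((l : ℝ) - 1 + 1 * s) / (1 + 1 * s)) *
        (((l : ℝ) + 2 + 1 * s) / (2 * l + 2 + 1 * s))))) atTop
      (𝓝 ((1 / 1) ^ k * ((β * x) * ((1 / 1) * (1 / 1))))) :=
    ((tendsto_add_mul_div_add_mul_atTop_nhds _ _ _ one_ne_zero).pow k).mul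
      (((tendsto_add_mul_div_add_mul_atTop_nhds _ _ _ one_ne_zero).mul
        (tendsto_add_mul_div_add_mul_atTop_nhds _ _ _ one_ne_zero)).const_mul _)
  refine summable_of_ratio_test_tendsto_lt_one hβx (.of_forall fun s => (hpos s).ne') ?_
  convert hlim using 2
  · rename_i s
    rw [Real.norm_of_nonneg (hpos _).le, Real.norm_of_nonneg (hpos _).le, hrec s]
    have h0 : c s ≠ 0 := (hc s).ne'
    have h1 : ((l : ℝ) + s) ≠ 0 := by positivity
    have h2 : (2 * (l : ℝ) + s + 2) ≠ 0 := by positivity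
    have h3 : ((s : ℝ) + 1) ≠ 0 := by positivity
    have h4 : (2 * (l : ℝ) + 2 + s) ≠ 0 := by positivity
    have h5 : (1 + (s : ℝ)) ≠ 0 := by positivity
    push_cast
    simp only [one_mul]
    rw [div_pow, ← add_assoc l s 1, pow_succ x]
    field_simp
    ring
  · simp

/-- Termwise differentiation in `r` of the series `∑ (l+s)^k c_s (R/r)^(l+s)`. -/
lemma hasDerivAt_tsum_inverse_powers {l : ℕ} {R a : ℝ} (hR : 0 < R) (ha : 0 ≤ a) {c : ℕ → ℝ}
    (hc : ∀ s, 0 < c s)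
    (hsum : ∀ k : ℕ, ∀ r : ℝ, a < r →
      Summable fun s : ℕ => ((l : ℝ) + s) ^ k * (c s * (R / r) ^ (l + s)))
    (k : ℕ) {r : ℝ} (hr : a < r) :
    HasDerivAt (fun y : ℝ => ∑' s : ℕ, ((l : ℝ) + s) ^ k * (c s * (R / y) ^ (l + s)))
      (-(∑' s : ℕ, ((l : ℝ) + s) ^ (k + 1) * (c s * (R / r) ^ (l + s))) / r) r := by
  obtain ⟨b, hab, hbr⟩ := exists_between hr
  have hb : 0 < b := ha.trans_lt hab
  rw [← tsum_neg, ← tsum_div_const]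
  refine hasDerivAt_tsum_of_isPreconnected
    (g := fun (s : ℕ) (y : ℝ) => ((l : ℝ) + s) ^ k * (c s * (R / y) ^ (l + s)))
    (g' := fun (s : ℕ) (y : ℝ) => -(((l : ℝ) + s) ^ (k + 1) * (c s * (R / y) ^ (l + s))) / y)
    ((hsum (k + 1) b hab).div_const b) isOpen_Ioi isPreconnected_Ioi
    ?_ ?_ (Set.mem_Ioi.2 hbr) (hsum k r hr) (Set.mem_Ioi.2 hbr)
  · intro s y hy
    have hy0 : y ≠ 0 := (hb.trans hy).ne'
    have hd : HasDerivAt (fun y : ℝ => R / y) (-R / y ^ 2) y := by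
      exact ((hasDerivAt_const y R).div (hasDerivAt_id y) hy0).congr_deriv (by simp)
    refine (((hd.pow (l + s)).const_mul (c s)).const_mul (((l : ℝ) + s) ^ k)).congr_deriv ?_
    rcases Nat.eq_zero_or_pos (l + s) with h0 | h0
    · have : (l : ℝ) + s = 0 := by exact_mod_cast h0
      simp [h0, this]
    · obtain ⟨m, hm⟩ := Nat.exists_eq_succ_of_ne_zero h0.ne'
      rw [hm]
      have : (l : ℝ) + s = m + 1 := by exact_mod_cast hm
      rw [this]
      simp only [Nat.succ_eq_add_one, Nat.add_sub_cancel, pow_succ]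
      push_cast
      field_simp
  · intro s y hy
    have hy' : b < y := hy
    have hy0 : 0 < y := hb.trans hy
    have := hc s
    rw [norm_div, norm_neg, Real.norm_of_nonneg (by positivity), Real.norm_of_nonneg hy0.le]
    gcongr


/-- The power-series solution `h(r) = Σ_{s} ĥ_s (R/r)^{l+s}` of the vacuum
axial perturbation equation, with `ĥ₀ = 1` and
`ĥ_s = (2M₀/R)·(l+s−2)(l+s+1)/(s(2l+s+1))·ĥ_{s−1}`, converges absolutely for
`r > 2M₀`, is twice differentiable on `(2M₀, ∞)`, tends to `0` at infinity, and
satisfies `(1 − 2M₀/r)h'' − (l(l+1)/r² − 4M₀/r³)h = 0` there. -/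
theorem exterior_axial_series_solution
    (l : ℕ) (hl : 2 ≤ l) (R M₀ : ℝ) (hR : 0 < R)
    (hM : M₀ ∈ Set.Ioo (0:ℝ) (R / 2))
    (c : ℕ → ℝ) (hc0 : c 0 = 1)
    (hcrec : ∀ s : ℕ, 1 ≤ s →
      c s = (2 * M₀ / R) * (((l : ℝ) + s - 2) * ((l : ℝ) + s + 1))
        / ((s : ℝ) * (2 * (l : ℝ) + s + 1)) * c (s - 1)) :
    (∀ r : ℝ, 2 * M₀ < r → Summable (fun s : ℕ => |c s * (R / r) ^ (l + s)|)) ∧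
    (∀ h : ℝ → ℝ, (∀ r : ℝ, h r = ∑' s : ℕ, c s * (R / r) ^ (l + s)) →
      (∀ r ∈ Set.Ioi (2 * M₀),
        DifferentiableAt ℝ h r ∧ DifferentiableAt ℝ (deriv h) r) ∧
      Filter.Tendsto h Filter.atTop (nhds 0) ∧
      (∀ r ∈ Set.Ioi (2 * M₀),
        (1 - 2 * M₀ / r) * deriv (deriv h) r
          - ((l : ℝ) * ((l : ℝ) + 1) / r ^ 2 - 4 * M₀ / r ^ 3) * h r = 0)) := by
  have hM0 := hM.1
  have hMR : 2 * M₀ < R := by linarith [hM.2]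
  have hl' : (2 : ℝ) ≤ l := by exact_mod_cast hl
  have hrec : ∀ s : ℕ, c (s + 1) =
      (2 * M₀ / R) * (((l : ℝ) + s - 1) * (l + s + 2)) / ((s + 1) * (2 * l + s + 2)) * c s := by
    intro s
    rw [hcrec (s + 1) (by omega), Nat.add_sub_cancel]
    push_cast
    congr 3 <;> ring
  have hc : ∀ s, 0 < c s := by
    intro s
    induction s with
    | zero => simp [hc0]
    | succ s ih =>
      rw [hrec s]
      have : 0 < (l : ℝ) + s - 1 := by
        have : (0 : ℝ) ≤ s := s.cast_nonneg
        linarith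
      positivity
  have hsum : ∀ k : ℕ, ∀ r : ℝ, 2 * M₀ < r →
      Summable fun s : ℕ => ((l : ℝ) + s) ^ k * (c s * (R / r) ^ (l + s)) := by
    intro k r hr
    have hr0 : 0 < r := by linarith
    refine summable_axial_moments hl hc hrec k (div_pos hR hr0) ?_
    rw [div_mul_div_cancel₀ hR.ne', div_lt_one hr0]
    exact hr
  have hsum0 : ∀ r : ℝ, 2 * M₀ < r → Summable fun s : ℕ => c s * (R / r) ^ (l + s) :=
    fun r hr => by simpa using hsum 0 r hr
  refine ⟨fun r hr => (hsum0 r hr).abs, fun h hh => ?_⟩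
  set F : ℕ → ℝ → ℝ := fun k r => ∑' s : ℕ, ((l : ℝ) + s) ^ k * (c s * (R / r) ^ (l + s)) with hF
  have hF0 : h = F 0 := by
    funext r
    simp [hF, hh]
  have hFd : ∀ k r, 2 * M₀ < r → HasDerivAt (F k) (-F (k + 1) r / r) r := fun k r hr =>
    hasDerivAt_tsum_inverse_powers hR (by linarith) hc hsum k hr
  have hd1 : ∀ r, 2 * M₀ < r → HasDerivAt h (-F 1 r / r) r := fun r hr => hF0 ▸ hFd 0 r hr
  have hd2 : ∀ r, 2 * M₀ < r → HasDerivAt (deriv h) ((F 2 r + F 1 r) / r ^ 2) r := by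
    intro r hr
    have hr0 : r ≠ 0 := by linarith
    have heq : deriv h =ᶠ[nhds r] fun y => -F 1 y / y := by
      filter_upwards [Ioi_mem_nhds hr] with y hy using (hd1 y hy).deriv
    refine HasDerivAt.congr_of_eventuallyEq ?_ heq
    refine ((hFd 1 r hr).neg.div (hasDerivAt_id r) hr0).congr_deriv ?_
    simp only [id, Pi.neg_apply]
    field_simp
    ring
  refine ⟨fun r hr => ⟨(hd1 r hr).differentiableAt, (hd2 r hr).differentiableAt⟩, ?_, ?_⟩
  · rw [show h = fun r => ∑' s : ℕ, c s * (R / r) ^ (l + s) from funext hh,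
      ← tsum_zero (α := ℝ) (β := ℕ)]
    refine tendsto_tsum_of_dominated_convergence (hsum0 R hMR) (fun s => ?_) ?_
    · have h1 : Filter.Tendsto (fun r : ℝ => R / r) Filter.atTop (nhds 0) :=
        Filter.tendsto_id.const_div_atTop R
      simpa only [zero_pow (show l + s ≠ 0 by omega), mul_zero] using
        (h1.pow (l + s)).const_mul (c s)
    · filter_upwards [Filter.eventually_ge_atTop R] with r hr s
      have := hc s
      have hr0 : 0 < r := hR.trans_le hr
      rw [Real.norm_of_nonneg (by positivity)]
      gcongr
  · intro r hr
    have hr' : 2 * M₀ < r := hr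
    have hr0 : r ≠ 0 := by linarith
    rw [(hd2 r hr).deriv, hF0]
    have hS : ∀ k, HasSum (fun s : ℕ => ((l : ℝ) + s) ^ k * (c s * (R / r) ^ (l + s))) (F k r) :=
      fun k => (hsum k r hr).hasSum
    have hA := ((hS 2).add (hS 1)).sub ((hS 0).mul_left ((l : ℝ) * (l + 1)))
    have hB := (((hS 2).add (hS 1)).sub ((hS 0).mul_left 2)).mul_left (2 * M₀ / r)
    rw [← hasSum_nat_add_iff' 1] at hA
    have key := hA.unique (hB.congr_fun ?_)
    · simp only [Finset.sum_range_one, Nat.cast_zero, add_zero, pow_zero] at key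
      field_simp at key ⊢
      linear_combination key
    · intro s
      have h2 : (2 * (l : ℝ) + s + 2) ≠ 0 := by positivity
      have h3 : ((s : ℝ) + 1) ≠ 0 := by positivity
      rw [hrec s, ← add_assoc l s 1, pow_succ (R / r)]
      push_cast
      generalize (R / r) ^ (l + s) = X
      field_simp
      ring
end

section
/- Let R > 0, let a : (0, R] → ℝ be continuously differentiable with a'(r) ≥ 0 for all r ∈ (0,R], and let ω̄ : (0, R] → ℝ be twice continuously differentiable and positive, satisfying Hartle's equation ω̄''(r) + (4/r − a'(r))·ω̄'(r) − (4·a'(r)/r)·ω̄(r) = 0 on (0,R] together with the central regularity condition lim_{r→0⁺} r⁴·e^{−a(r)}·ω̄'(r) = 0. Then ω̄'(r) ≥ 0 for all r ∈ (0,R], so that ω̄ is nondecreasing on (0,R]; and if in addition ω̄(R) + (R/3)·ω̄'(R) = Ω for some real Ω, then ω̄(r) ≤ ω̄(R) ≤ Ω for all r ∈ (0,R]. -/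
/-- A function that is monotone on `(0, R]` and tends to `0` at `0⁺` is nonnegative. -/
theorem MonotoneOn.nonneg_of_tendsto_zero {R : ℝ} {F : ℝ → ℝ}
    (hF : MonotoneOn F (Set.Ioc 0 R))
    (h0 : Filter.Tendsto F (nhdsWithin 0 (Set.Ioi 0)) (nhds 0)) :
    ∀ r ∈ Set.Ioc (0:ℝ) R, 0 ≤ F r := by
  intro r hr
  refine le_of_tendsto h0 ?_
  filter_upwards [Ioc_mem_nhdsGT hr.1] with s hs
  exact hF ⟨hs.1, hs.2.trans hr.2⟩ hr hs.2

/-- A function differentiable at each point of `(0, R]` with nonnegative derivative there is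
monotone on `(0, R]`. -/
theorem monotoneOn_Ioc_of_hasDerivAt_nonneg {R : ℝ} {f f' : ℝ → ℝ}
    (hf : ∀ r ∈ Set.Ioc (0:ℝ) R, HasDerivAt f (f' r) r)
    (hf' : ∀ r ∈ Set.Ioc (0:ℝ) R, 0 ≤ f' r) : MonotoneOn f (Set.Ioc 0 R) :=
  monotoneOn_of_hasDerivWithinAt_nonneg (convex_Ioc 0 R)
    (fun r hr => (hf r hr).continuousAt.continuousWithinAt)
    (fun r hr => (hf r (interior_subset hr)).hasDerivWithinAt)
    (fun r hr => hf' r (interior_subset hr))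


/-- For Hartle's equation
`ω̄'' + (4/r − a')·ω̄' − (4a'/r)·ω̄ = 0` on `(0,R]` with `a' ≥ 0`, `ω̄ > 0`, and the
central regularity condition `r⁴·e^{−a}·ω̄' → 0` as `r → 0⁺`, one has `ω̄' ≥ 0` on
`(0,R]`, so `ω̄` is nondecreasing there; and if `ω̄(R) + (R/3)ω̄'(R) = Ω`, then
`ω̄(r) ≤ ω̄(R) ≤ Ω` for all `r ∈ (0,R]`. -/
theorem hartle_frame_dragging_monotone
    (R Ω : ℝ) (hR : 0 < R) (a w : ℝ → ℝ)
    (ha : ∀ r ∈ Set.Ioc (0:ℝ) R, DifferentiableAt ℝ a r)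
    (ha' : ContinuousOn (deriv a) (Set.Ioc 0 R))
    (ha'nn : ∀ r ∈ Set.Ioc (0:ℝ) R, 0 ≤ deriv a r)
    (hw1 : ∀ r ∈ Set.Ioc (0:ℝ) R, DifferentiableAt ℝ w r)
    (hw2 : ∀ r ∈ Set.Ioc (0:ℝ) R, DifferentiableAt ℝ (deriv w) r)
    (hw2c : ContinuousOn (deriv (deriv w)) (Set.Ioc 0 R))
    (hwpos : ∀ r ∈ Set.Ioc (0:ℝ) R, 0 < w r)
    (hartle : ∀ r ∈ Set.Ioc (0:ℝ) R,
      deriv (deriv w) r + (4 / r - deriv a r) * deriv w r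
        - (4 * deriv a r / r) * w r = 0)
    (hreg : Filter.Tendsto (fun r => r ^ 4 * Real.exp (-(a r)) * deriv w r)
      (nhdsWithin 0 (Set.Ioi 0)) (nhds 0)) :
    (∀ r ∈ Set.Ioc (0:ℝ) R, 0 ≤ deriv w r) ∧
    MonotoneOn w (Set.Ioc 0 R) ∧
    (w R + (R / 3) * deriv w R = Ω →
      ∀ r ∈ Set.Ioc (0:ℝ) R, w r ≤ w R ∧ w R ≤ Ω) := by
  have hmono : MonotoneOn (fun r => r ^ 4 * Real.exp (-(a r)) * deriv w r) (Set.Ioc 0 R) := by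
    refine monotoneOn_Ioc_of_hasDerivAt_nonneg
      (f' := fun r => r ^ 4 * Real.exp (-(a r)) * ((4 * deriv a r / r) * w r)) ?_ ?_
    · intro r hr
      have hr0 : r ≠ 0 := hr.1.ne'
      have h := ((hasDerivAt_pow 4 r).mul (ha r hr).hasDerivAt.neg.exp).mul
        (hw2 r hr).hasDerivAt
      refine h.congr_deriv ?_
      have hw'' : deriv (deriv w) r =
          (4 * deriv a r / r) * w r - (4 / r - deriv a r) * deriv w r := by
        linarith [hartle r hr]
      simp only [Pi.mul_apply, Pi.neg_apply]
      rw [hw'']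
      field_simp
      push_cast
      ring
    · intro r hr
      have := hr.1
      have := ha'nn r hr
      have := hwpos r hr
      positivity
  have hderiv : ∀ r ∈ Set.Ioc (0:ℝ) R, 0 ≤ deriv w r := fun r hr =>
    nonneg_of_mul_nonneg_right (hmono.nonneg_of_tendsto_zero hreg r hr)
      (mul_pos (pow_pos hr.1 4) (Real.exp_pos _))
  have hw : MonotoneOn w (Set.Ioc 0 R) :=
    monotoneOn_Ioc_of_hasDerivAt_nonneg (fun r hr => (hw1 r hr).hasDerivAt) hderiv
  have hRmem : R ∈ Set.Ioc (0:ℝ) R := ⟨hR, le_rfl⟩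
  refine ⟨hderiv, hw, fun hΩ r hr => ⟨hw hr hRmem hr.2, ?_⟩⟩
  have : 0 ≤ R / 3 * deriv w R := mul_nonneg (by positivity) (hderiv R hRmem)
  linarith
end

section
/- Let R > 0 and M₀ > 0 with 2M₀/R < 8/9. Define the constant ε = 3M₀/(4πR³) and, for r ∈ [0,R], M(r) = M₀(r/R)³, y(r) = √(1 − (2M₀/R)(r/R)²), y₁ = √(1 − 2M₀/R), p(r) = ε·(y(r) − y₁)/(3y₁ − y(r)), and ν(r) = ln((3/2)y₁ − (1/2)y(r)). Then for all r ∈ (0,R): 3y₁ − y(r) > 0; p(r) ≥ 0 with p(R) = 0; M'(r) = 4π·r²·ε; p'(r) = −(ε + p(r))·(M(r) + 4π·r³·p(r))/(r·(r − 2M(r))); and ν'(r) = −p'(r)/(ε + p(r)). -/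
/-- The interior Schwarzschild (uniform density) solution: with
`ε = 3M₀/(4πR³)`, `M(r) = M₀(r/R)³`, `y(r) = √(1 − (2M₀/R)(r/R)²)`,
`y₁ = √(1 − 2M₀/R)`, `p = ε(y − y₁)/(3y₁ − y)`, `ν = ln((3/2)y₁ − (1/2)y)`,
and `2M₀/R < 8/9`, one has on `(0,R)`: `3y₁ − y > 0`, `p ≥ 0` with `p(R) = 0`,
`M' = 4πr²ε`, the TOV equation for `p'`, and `ν' = −p'/(ε+p)`. -/
theorem interior_schwarzschild_solution
    (R M₀ : ℝ) (hR : 0 < R) (hM₀ : 0 < M₀) (hcomp : 2 * M₀ / R < 8 / 9)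
    (eps y₁ : ℝ) (M y p ν : ℝ → ℝ)
    (heps : eps = 3 * M₀ / (4 * Real.pi * R ^ 3))
    (hy₁ : y₁ = Real.sqrt (1 - 2 * M₀ / R))
    (hMdef : ∀ r, M r = M₀ * (r / R) ^ 3)
    (hydef : ∀ r, y r = Real.sqrt (1 - (2 * M₀ / R) * (r / R) ^ 2))
    (hpdef : ∀ r, p r = eps * (y r - y₁) / (3 * y₁ - y r))
    (hνdef : ∀ r, ν r = Real.log ((3 / 2) * y₁ - (1 / 2) * y r)) :
    (∀ r ∈ Set.Ioo (0:ℝ) R, 0 < 3 * y₁ - y r) ∧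
    (∀ r ∈ Set.Ioo (0:ℝ) R, 0 ≤ p r) ∧ p R = 0 ∧
    (∀ r ∈ Set.Ioo (0:ℝ) R, HasDerivAt M (4 * Real.pi * r ^ 2 * eps) r) ∧
    (∀ r ∈ Set.Ioo (0:ℝ) R,
      HasDerivAt p (-(eps + p r) * (M r + 4 * Real.pi * r ^ 3 * p r)
        / (r * (r - 2 * M r))) r) ∧
    (∀ r ∈ Set.Ioo (0:ℝ) R, HasDerivAt ν (-(deriv p r) / (eps + p r)) r) := by
  have hRne : R ≠ 0 := hR.ne'
  have hπ := Real.pi_pos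
  have hπne : Real.pi ≠ 0 := hπ.ne'
  have heps_pos : 0 < eps := by rw [heps]; positivity
  have hc : 0 < 2 * M₀ / R := by positivity
  have hy₁_third : 1 / 3 < y₁ := by
    rw [hy₁]
    apply Real.lt_sqrt_of_sq_lt
    linarith
  have hy_lt_one : ∀ r ∈ Set.Ioo (0 : ℝ) R, y r < 1 := by
    intro r hr
    have h : 0 < r / R := div_pos hr.1 hR
    rw [hydef, Real.sqrt_lt' one_pos]
    have := mul_pos hc (pow_pos h 2)
    linarith
  have hy_gt : ∀ r ∈ Set.Ioo (0 : ℝ) R, y₁ < y r := by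
    intro r hr
    have h : 0 < r / R := div_pos hr.1 hR
    have h1 : r / R < 1 := (div_lt_one hR).2 hr.2
    rw [hydef, hy₁]
    apply Real.sqrt_lt_sqrt
    · linarith
    · nlinarith [mul_lt_mul_of_pos_left (show (r / R) ^ 2 < 1 by nlinarith) hc]
  have hden : ∀ r ∈ Set.Ioo (0 : ℝ) R, 0 < 3 * y₁ - y r := fun r hr => by
    linarith [hy_lt_one r hr]
  have hsq : ∀ r ∈ Set.Ioo (0 : ℝ) R, y r ^ 2 = 1 - (2 * M₀ / R) * (r / R) ^ 2 := by
    intro r hr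
    have hpos : 0 < y r := by linarith [hy_gt r hr]
    rw [hydef] at hpos ⊢
    exact Real.sq_sqrt (Real.sqrt_pos.1 hpos).le
  have hy_deriv : ∀ r ∈ Set.Ioo (0 : ℝ) R,
      HasDerivAt y (-(2 * M₀ / R ^ 3 * r) / y r) r := by
    intro r hr
    have hpos : 0 < y r := by linarith [hy_gt r hr]
    have hinner : HasDerivAt (fun s : ℝ => 1 - (2 * M₀ / R) * (s / R) ^ 2)
        (-((2 * M₀ / R) * (2 * (r / R) * (1 / R)))) r := by
      simpa using ((((hasDerivAt_id r).div_const R).pow 2).const_mul (2 * M₀ / R)).const_sub 1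
    have h := hinner.sqrt (by rw [← hsq r hr]; positivity)
    rw [← hydef r, ← funext hydef] at h
    refine h.congr_deriv ?_
    field_simp
  have hp_deriv : ∀ r ∈ Set.Ioo (0 : ℝ) R,
      HasDerivAt p (eps * (-(2 * M₀ / R ^ 3 * r) / y r) * (2 * y₁) / (3 * y₁ - y r) ^ 2) r := by
    intro r hr
    rw [funext hpdef]
    have hyr := hy_deriv r hr
    refine (((hyr.sub_const y₁).const_mul eps).fun_div (hyr.const_sub (3 * y₁))
      (hden r hr).ne').congr_deriv ?_
    ring
  have heps_add : ∀ r ∈ Set.Ioo (0 : ℝ) R, eps + p r = eps * (2 * y₁) / (3 * y₁ - y r) := by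
    intro r hr
    have hd := (hden r hr).ne'
    rw [hpdef, eq_div_iff hd, add_mul, div_mul_cancel₀ _ hd]
    ring
  refine ⟨hden, ?_, ?_, ?_, ?_, ?_⟩
  · intro r hr
    rw [hpdef]
    exact div_nonneg (mul_nonneg heps_pos.le (by linarith [hy_gt r hr])) (hden r hr).le
  · rw [hpdef, hydef, hy₁]
    simp [hRne]
  · intro r _
    rw [funext hMdef]
    refine ((((hasDerivAt_id' r).div_const R).fun_pow 3).const_mul M₀).congr_deriv ?_
    rw [heps]
    field_simp
    push_cast
    field_simp
  · intro r hr
    refine (hp_deriv r hr).congr_deriv ?_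
    have hd := (hden r hr).ne'
    have hrne := hr.1.ne'
    have hyne : y r ≠ 0 := (show 0 < y r by linarith [hy_gt r hr]).ne'
    have hM : r * (r - 2 * M r) = r ^ 2 * y r ^ 2 := by
      rw [hsq r hr, hMdef]
      field_simp
    have hsum : M r + 4 * Real.pi * r ^ 3 * p r
        = 2 * M₀ / R ^ 3 * r ^ 3 * y r / (3 * y₁ - y r) := by
      rw [hMdef, hpdef, heps]
      field_simp
      ring
    rw [hM, hsum, heps_add r hr]
    field_simp
  · intro r hr
    have hd := hden r hr
    have hy₁ne : y₁ ≠ 0 := (show 0 < y₁ by linarith).ne'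
    rw [(hp_deriv r hr).deriv, heps_add r hr, funext hνdef]
    refine ((((hy_deriv r hr).const_mul (1 / 2)).const_sub ((3 / 2) * y₁)).log
      (by linarith : (0 : ℝ) < (3 / 2) * y₁ - (1 / 2) * y r).ne').congr_deriv ?_
    rw [show (3 / 2) * y₁ - (1 / 2) * y r = (3 * y₁ - y r) / 2 by ring]
    field_simp
end

section
/- Let R > 0 and x ∈ ℝ, and define ω̄(r) = 1 − (1 − 3r²/(5R²))·x and b(r) = (3/2)·(r²/R²)·x for r ∈ [0,R]. Then for every r ∈ [0,R], r²·ω̄''(r) + (4 − b(r))·r·ω̄'(r) − 4·b(r)·ω̄(r) = x²·(6r²/R² − 27r⁴/(5R⁴)), so that ω̄ satisfies Hartle's equation r²ω̄'' + (4 − r(ν'+λ'))rω̄' − 4r(ν'+λ')ω̄ = 0 with r(ν'+λ') = b(r) up to a remainder of order x². Moreover, ω̄(R) + (R/3)·ω̄'(R) = 1 exactly. -/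
/-- The post-Newtonian frame-dragging function
`ω̄(r) = 1 − (1 − 3r²/(5R²))x` satisfies Hartle's equation with coefficient
`b(r) = (3/2)(r²/R²)x` up to a remainder of order `x²`:
`r²ω̄'' + (4 − b)rω̄' − 4bω̄ = x²(6r²/R² − 27r⁴/(5R⁴))` on `[0,R]`, and the
surface normalization `ω̄(R) + (R/3)ω̄'(R) = 1` holds exactly. -/
theorem post_newtonian_frame_dragging_solution
    (R x : ℝ) (hR : 0 < R) (w b : ℝ → ℝ)
    (hw : ∀ r : ℝ, w r = 1 - (1 - 3 * r ^ 2 / (5 * R ^ 2)) * x)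
    (hb : ∀ r : ℝ, b r = (3 / 2) * (r ^ 2 / R ^ 2) * x) :
    (∀ r ∈ Set.Icc (0:ℝ) R,
      r ^ 2 * deriv (deriv w) r + (4 - b r) * (r * deriv w r) - 4 * b r * w r
        = x ^ 2 * (6 * r ^ 2 / R ^ 2 - 27 * r ^ 4 / (5 * R ^ 4))) ∧
    w R + (R / 3) * deriv w R = 1 := by
  have hw' : deriv w = fun r => 6 * x / (5 * R ^ 2) * r := by
    funext r
    have h : HasDerivAt w (-(-(3 * (2 * r) / (5 * R ^ 2)) * x)) r := by
      rw [funext hw]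
      simpa using (((((hasDerivAt_pow 2 r).const_mul 3).div_const
        (5 * R ^ 2)).const_sub 1).mul_const x).const_sub 1
    rw [h.deriv]
    ring
  have hw'' (r : ℝ) : deriv (deriv w) r = 6 * x / (5 * R ^ 2) := by
    rw [hw']
    simp
  constructor
  · intro r _
    rw [hw'', hw', hw, hb]
    field_simp
    ring
  · rw [hw', hw]
    field_simp
    ring
end

section
/- Consider a static spherically symmetric relativistic stellar model of radius R > 0 and mass M₀ ∈ (0, R/2): continuous nonnegative ε, p : (0,∞) → ℝ vanishing for r ≥ R; differentiable M : (0,∞) → ℝ with M'(r) = 4πr²ε(r), M(r) = M₀ for r ≥ R, and 2M(r) < r for all r > 0; λ(r) = −(1/2)ln(1 − 2M(r)/r); differentiable ν : (0,∞) → ℝ with ν'(r) = (M(r)+4πr³p(r))/(r(r−2M(r))) and e^{2ν(r)} = 1 − 2M₀/r for r ≥ R. Let ω̃ : [0,∞) → ℝ be continuous, twice differentiable on (0,∞), satisfy Hartle's equation ω̃'' + (4/r − (ν+λ)')ω̃' − (4/r)(ν+λ)'ω̃ = 0 on (0,R), and equal 1 − 2J̃/r³ for r ≥ R for some constant J̃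 > 0. Let l ≥ 2 be an integer and α ∈ ℝ with α ≠ ω̃(r) for every r ∈ [0,∞). Suppose h : (0,∞) → ℝ is twice continuously differentiable and satisfies Kojima's master equation (α − ω̃)·{ e^{ν−λ}·(e^{−ν−λ}h')' − [l(l+1)/r² − 4M/r³ + 8π(p+ε)]·h } + 16π(p+ε)·α·h = 0 on (0,∞), and that f(r) = h(r)/(r²(α − ω̃(r))) is continuously differentiable with f(r) → 0 as r → 0⁺ and as r → ∞, with finite integrals ∫₀^∞ (α−ω̃)² r⁴ e^{−λ−ν} (f')² dr and ∫₀^∞ (α−ω̃)² r² e^{λ−ν} f² dr, and with r⁴e^{−λ−ν}(α−ω̃)²·f·f' → 0 as r → 0⁺ and as r → ∞. Then −∫₀^∞ (α−ω̃)² r⁴ e^{−λ−ν} (f'(r))² dr = ∫₀^∞ (α−ω̃)²·(l(l+1)−2)·r² e^{λ−ν} (f(r))² dr, and therefore f ≡ 0 and h ≡ 0. Hence a nontrivial regular solution of Kojima's master equation exists only if α = ω̃(r) for some r ∈ [0,∞), i.e. only if α lies in the closed range of ω̃, which is contained in [ω̃(0), 1]. -/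
open MeasureTheory

open Filter Topology

/-- A function with nonnegative derivative on `(0,∞)` that tends to `0` at both ends has
vanishing derivative there. -/
lemma deriv_eq_zero_of_nonneg_of_tendsto_zero {F D : ℝ → ℝ}
    (hF : ∀ r > (0:ℝ), HasDerivAt F (D r) r) (hD : ∀ r > (0:ℝ), 0 ≤ D r)
    (h0 : Tendsto F (𝓝[>] 0) (𝓝 0)) (hinf : Tendsto F atTop (𝓝 0)) :
    ∀ r > (0:ℝ), D r = 0 := by
  have hmono : MonotoneOn F (Set.Ioi 0) := by
    refine monotoneOn_of_hasDerivWithinAt_nonneg (f' := D) (convex_Ioi 0)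
      (fun r hr => (hF r hr).continuousAt.continuousWithinAt) ?_ ?_
    · intro r hr
      exact (hF r (interior_subset hr)).hasDerivWithinAt
    · intro r hr
      exact hD r (interior_subset hr)
  have hzero : ∀ r > (0:ℝ), F r = 0 := by
    intro r hr
    apply le_antisymm
    · refine ge_of_tendsto hinf ?_
      filter_upwards [eventually_ge_atTop r] with s hs
      exact hmono hr (lt_of_lt_of_le hr hs) hs
    · refine le_of_tendsto h0 ?_
      filter_upwards [Ioo_mem_nhdsGT hr] with s hs
      exact hmono hs.1 hr hs.2.le
  intro r hr
  refine (hF r hr).unique ((hasDerivAt_const r (0:ℝ)).congr_of_eventuallyEq ?_)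
  filter_upwards [Ioi_mem_nhds hr] with s hs
  exact hzero s hs

/-- If `f` is differentiable at `r` and agrees with `g` on `[r,∞)`, then both have the same
derivative at `r`. -/
lemma deriv_eq_of_eqOn_Ici {f g : ℝ → ℝ} {g' r : ℝ} (hg : HasDerivAt g g' r)
    (hf : DifferentiableAt ℝ f r) (hfg : Set.EqOn f g (Set.Ici r)) : deriv f r = g' :=
  (uniqueDiffOn_Ici r r Set.self_mem_Ici).eq_deriv (Set.Ici r) hf.hasDerivAt.hasDerivWithinAt
    (hg.hasDerivWithinAt.congr hfg (hfg Set.self_mem_Ici))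

/-- The exterior frame-dragging function satisfies the vacuum form of Hartle's equation, up to
and including the surface. -/
lemma hartle_exterior {ω : ℝ → ℝ} {R J : ℝ} (hR : 0 < R)
    (hωdiff : ∀ r > (0:ℝ), DifferentiableAt ℝ ω r ∧ DifferentiableAt ℝ (deriv ω) r)
    (hωout : ∀ r ≥ R, ω r = 1 - 2 * J / r ^ 3) {r : ℝ} (hr : R ≤ r) :
    deriv (deriv ω) r + 4 / r * deriv ω r = 0 := by
  have h1 : ∀ s ≥ R, deriv ω s = 6 * J / s ^ 4 := by
    intro s hs
    have hs0 : 0 < s := hR.trans_le hs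
    refine deriv_eq_of_eqOn_Ici (g := fun t => 1 - 2 * J / t ^ 3) ?_
      (hωdiff s hs0).1 (fun t ht => hωout t (hs.trans ht))
    refine (((hasDerivAt_const s (2 * J)).fun_div (hasDerivAt_pow 3 s)
      (by positivity)).const_sub 1).congr_deriv ?_
    field_simp
    ring
  have hr0 : 0 < r := hR.trans_le hr
  have h2 : deriv (deriv ω) r = -(24 * J / r ^ 5) := by
    refine deriv_eq_of_eqOn_Ici (g := fun t => 6 * J / t ^ 4) ?_
      (hωdiff r hr0).2 (fun t ht => h1 t (hr.trans ht))
    refine ((hasDerivAt_const r (6 * J)).fun_div (hasDerivAt_pow 4 r)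
      (by positivity)).congr_deriv ?_
    field_simp
    ring
  rw [h2, h1 r hr]
  field_simp
  ring

/-- The derivative of the metric potential `λ = -(1/2) ln (1 - 2M/r)`. -/
lemma hasDerivAt_metric_potential {M lam : ℝ → ℝ} {r M' : ℝ} (hr : 0 < r)
    (hM' : HasDerivAt M M' r) (hMlt : 2 * M r < r)
    (hlam : ∀ r > (0:ℝ), lam r = -(1 / 2) * Real.log (1 - 2 * M r / r)) :
    HasDerivAt lam ((r * M' - M r) / (r * (r - 2 * M r))) r := by
  have hk : 1 - 2 * M r / r ≠ 0 := by
    rw [one_sub_div hr.ne']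
    exact (div_pos (sub_pos.2 hMlt) hr).ne'
  have hk' : r - 2 * M r ≠ 0 := (sub_pos.2 hMlt).ne'
  have hd : HasDerivAt (fun s => -(1 / 2) * Real.log (1 - 2 * M s / s))
      ((r * M' - M r) / (r * (r - 2 * M r))) r := by
    refine (((((hM'.const_mul 2).fun_div (hasDerivAt_id' r) hr.ne').const_sub 1).log
      hk).const_mul (-(1 / 2) : ℝ)).congr_deriv ?_
    rw [one_sub_div hr.ne']
    field_simp
  refine hd.congr_of_eventuallyEq ?_
  filter_upwards [Ioi_mem_nhds hr] with s hs
  exact hlam s hs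

/-- For `f = h / g`, the weighted derivative `g² W f'` equals the Wronskian `W (h' g - h g')`,
whose derivative is `(W h')' g - h (W g')'`. -/
lemma hasDerivAt_weighted_deriv_quotient {W g g₁ h f : ℝ → ℝ} {W' g₂ r : ℝ} (hr : 0 < r)
    (hW : HasDerivAt W W' r) (hg : ∀ s > (0:ℝ), HasDerivAt g (g₁ s) s)
    (hg₁ : HasDerivAt g₁ g₂ r) (hg0 : ∀ s > (0:ℝ), g s ≠ 0)
    (hh : ∀ s > (0:ℝ), DifferentiableAt ℝ h s ∧ DifferentiableAt ℝ (deriv h) s)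
    (hf : ∀ s > (0:ℝ), f s = h s / g s) :
    HasDerivAt (fun s => g s ^ 2 * W s * deriv f s)
      (deriv (fun s => W s * deriv h s) r * g r - h r * (W' * g₁ r + W r * g₂)) r := by
  have hWh : HasDerivAt (fun s => W s * deriv h s) (deriv (fun s => W s * deriv h s) r) r :=
    (hW.differentiableAt.mul (hh r hr).2).hasDerivAt
  have hd := (hWh.mul (hg r hr)).sub ((hh r hr).1.hasDerivAt.mul (hW.mul hg₁))
  have hd' : HasDerivAt (fun s => W s * deriv h s * g s - h s * (W s * g₁ s))
      (deriv (fun s => W s * deriv h s) r * g r - h r * (W' * g₁ r + W r * g₂)) r := by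
    refine hd.congr_deriv ?_
    simp only [Pi.mul_apply]
    ring
  refine hd'.congr_of_eventuallyEq ?_
  filter_upwards [Ioi_mem_nhds hr] with s hs
  have hs0 : (0:ℝ) < s := hs
  have hfs : deriv f s = (deriv h s * g s - h s * g₁ s) / g s ^ 2 := by
    refine HasDerivAt.deriv (((hh s hs0).1.hasDerivAt.fun_div (hg s hs0)
      (hg0 s hs0)).congr_of_eventuallyEq ?_)
    filter_upwards [Ioi_mem_nhds hs0] with t ht
    exact hf t ht
  have := hg0 s hs0
  rw [hfs]
  field_simp

/-- For a static spherical stellar model with Schwarzschild exterior and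
frame-dragging function `ω̃` satisfying Hartle's equation, if `α ≠ ω̃(r)` for every
`r ∈ [0,∞)` and `h` solves Kojima's master equation on `(0,∞)` with
`f(r) = h(r)/(r²(α−ω̃(r)))` regular (vanishing at `0⁺` and at `∞`, with finite weighted
integrals and vanishing boundary flux), then
`−∫₀^∞ (α−ω̃)² r⁴ e^{−λ−ν} (f')² = ∫₀^∞ (α−ω̃)² (l(l+1)−2) r² e^{λ−ν} f²`,
and therefore `f ≡ 0` and `h ≡ 0` on `(0,∞)`. -/
theorem kojima_master_equation_no_regular_solution
    (R M₀ : ℝ) (hR : 0 < R) (hM : M₀ ∈ Set.Ioo (0:ℝ) (R / 2))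
    (ε p M ν lam : ℝ → ℝ)
    (hεcont : ContinuousOn ε (Set.Ioi 0)) (hεnn : ∀ r > (0:ℝ), 0 ≤ ε r)
    (hεout : ∀ r ≥ R, ε r = 0)
    (hpcont : ContinuousOn p (Set.Ioi 0)) (hpnn : ∀ r > (0:ℝ), 0 ≤ p r)
    (hpout : ∀ r ≥ R, p r = 0)
    (hM' : ∀ r > (0:ℝ), HasDerivAt M (4 * Real.pi * r ^ 2 * ε r) r)
    (hMout : ∀ r ≥ R, M r = M₀)
    (hMlt : ∀ r > (0:ℝ), 2 * M r < r)
    (hlam : ∀ r > (0:ℝ), lam r = -(1 / 2) * Real.log (1 - 2 * M r / r))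
    (hν : ∀ r > (0:ℝ),
      HasDerivAt ν ((M r + 4 * Real.pi * r ^ 3 * p r) / (r * (r - 2 * M r))) r)
    (hνout : ∀ r ≥ R, Real.exp (2 * ν r) = 1 - 2 * M₀ / r)
    (ω : ℝ → ℝ) (J : ℝ) (hJ : 0 < J)
    (hωcont : ContinuousOn ω (Set.Ici 0))
    (hωdiff : ∀ r > (0:ℝ), DifferentiableAt ℝ ω r ∧ DifferentiableAt ℝ (deriv ω) r)
    (hωeq : ∀ r ∈ Set.Ioo (0:ℝ) R,
      deriv (deriv ω) r + (4 / r - (deriv ν r + deriv lam r)) * deriv ω r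
        - (4 / r) * (deriv ν r + deriv lam r) * ω r = 0)
    (hωout : ∀ r ≥ R, ω r = 1 - 2 * J / r ^ 3)
    (l : ℕ) (hl : 2 ≤ l) (α : ℝ) (hα : ∀ r ≥ (0:ℝ), α ≠ ω r)
    (h f : ℝ → ℝ)
    (hh : ∀ r > (0:ℝ), DifferentiableAt ℝ h r ∧ DifferentiableAt ℝ (deriv h) r)
    (hh2c : ContinuousOn (deriv (deriv h)) (Set.Ioi 0))
    (hKojima : ∀ r > (0:ℝ),
      (α - ω r) * (Real.exp (ν r - lam r)
          * deriv (fun s => Real.exp (-(ν s) - lam s) * deriv h s) r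
        - ((l : ℝ) * ((l : ℝ) + 1) / r ^ 2 - 4 * M r / r ^ 3
            + 8 * Real.pi * (p r + ε r)) * h r)
      + 16 * Real.pi * (p r + ε r) * α * h r = 0)
    (hfdef : ∀ r > (0:ℝ), f r = h r / (r ^ 2 * (α - ω r)))
    (hfC1 : ∀ r > (0:ℝ), DifferentiableAt ℝ f r)
    (hf'cont : ContinuousOn (deriv f) (Set.Ioi 0))
    (hf0 : Filter.Tendsto f (nhdsWithin 0 (Set.Ioi 0)) (nhds 0))
    (hfinf : Filter.Tendsto f Filter.atTop (nhds 0))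
    (hint1 : IntegrableOn
      (fun r => (α - ω r) ^ 2 * r ^ 4 * Real.exp (-(lam r) - ν r) * (deriv f r) ^ 2)
      (Set.Ioi 0))
    (hint2 : IntegrableOn
      (fun r => (α - ω r) ^ 2 * r ^ 2 * Real.exp (lam r - ν r) * (f r) ^ 2)
      (Set.Ioi 0))
    (hbdry0 : Filter.Tendsto
      (fun r => r ^ 4 * Real.exp (-(lam r) - ν r) * (α - ω r) ^ 2 * f r * deriv f r)
      (nhdsWithin 0 (Set.Ioi 0)) (nhds 0))
    (hbdryinf : Filter.Tendsto
      (fun r => r ^ 4 * Real.exp (-(lam r) - ν r) * (α - ω r) ^ 2 * f r * deriv f r)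
      Filter.atTop (nhds 0)) :
    (-(∫ r in Set.Ioi (0:ℝ),
        (α - ω r) ^ 2 * r ^ 4 * Real.exp (-(lam r) - ν r) * (deriv f r) ^ 2)
      = ∫ r in Set.Ioi (0:ℝ),
        (α - ω r) ^ 2 * ((l : ℝ) * ((l : ℝ) + 1) - 2) * r ^ 2
          * Real.exp (lam r - ν r) * (f r) ^ 2) ∧
    (∀ r > (0:ℝ), f r = 0) ∧ (∀ r > (0:ℝ), h r = 0) := by
  have hu : ∀ r > (0:ℝ), α - ω r ≠ 0 := fun r hr => sub_ne_zero.2 (hα r hr.le)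
  have hnu_lam : ∀ r > (0:ℝ), deriv ν r + deriv lam r
      = 4 * Real.pi * r ^ 2 * (p r + ε r) / (r - 2 * M r) := by
    intro r hr
    have hk : r - 2 * M r ≠ 0 := (sub_pos.2 (hMlt r hr)).ne'
    rw [(hν r hr).deriv, (hasDerivAt_metric_potential hr (hM' r hr) (hMlt r hr) hlam).deriv]
    field_simp
    ring
  have hhartle : ∀ r > (0:ℝ),
      deriv (deriv ω) r + (4 / r - (deriv ν r + deriv lam r)) * deriv ω r
        - (4 / r) * (deriv ν r + deriv lam r) * ω r = 0 := by
    intro r hr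
    rcases lt_or_ge r R with hrR | hrR
    · exact hωeq r ⟨hr, hrR⟩
    · rw [hnu_lam r hr, hεout r hrR, hpout r hrR]
      simpa using hartle_exterior hR hωdiff hωout hrR
  have hflux : ∀ r > (0:ℝ), HasDerivAt
      (fun s => (s ^ 2 * (α - ω s)) ^ 2 * Real.exp (-(ν s) - lam s) * deriv f s)
      ((α - ω r) ^ 2 * ((l : ℝ) * ((l : ℝ) + 1) - 2) * r ^ 2
          * Real.exp (lam r - ν r) * f r) r := by
    intro r hr
    have hg : ∀ s > (0:ℝ), HasDerivAt (fun s => s ^ 2 * (α - ω s))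
        (2 * s * (α - ω s) - s ^ 2 * deriv ω s) s := by
      intro s hs
      refine ((hasDerivAt_pow 2 s).fun_mul
        ((hωdiff s hs).1.hasDerivAt.const_sub α)).congr_deriv ?_
      push_cast
      ring
    have hg₁ : HasDerivAt (fun s => 2 * s * (α - ω s) - s ^ 2 * deriv ω s)
        (2 * (α - ω r) - 4 * r * deriv ω r - r ^ 2 * deriv (deriv ω) r) r := by
      refine ((((hasDerivAt_id' r).const_mul 2).fun_mul
        ((hωdiff r hr).1.hasDerivAt.const_sub α)).fun_sub
        ((hasDerivAt_pow 2 r).fun_mul (hωdiff r hr).2.hasDerivAt)).congr_deriv ?_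
      push_cast
      ring
    have hlam' : HasDerivAt lam (deriv lam r) r :=
      (hasDerivAt_metric_potential hr (hM' r hr) (hMlt r hr)
        hlam).differentiableAt.hasDerivAt
    have hW : HasDerivAt (fun s => Real.exp (-(ν s) - lam s))
        (Real.exp (-(ν r) - lam r) * (-(deriv ν r) - deriv lam r)) r :=
      ((hν r hr).differentiableAt.hasDerivAt.fun_neg.fun_sub hlam').exp
    refine (hasDerivAt_weighted_deriv_quotient hr hW hg hg₁
      (fun s hs => mul_ne_zero (pow_ne_zero 2 (ne_of_gt hs)) (hu s hs)) hh
      hfdef).congr_deriv ?_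
    have hk : 0 < 1 - 2 * M r / r := by
      rw [one_sub_div hr.ne']
      exact div_pos (sub_pos.2 (hMlt r hr)) hr
    have hexp : Real.exp (-(2 * lam r)) = 1 - 2 * M r / r := by
      rw [hlam r hr, ← Real.exp_log hk]
      congr 1
      rw [Real.exp_log hk]
      ring
    have hWV : Real.exp (-(ν r) - lam r) = (1 - 2 * M r / r) * Real.exp (lam r - ν r) := by
      rw [← hexp, ← Real.exp_add]
      ring_nf
    have hVE : Real.exp (lam r - ν r) * Real.exp (ν r - lam r) = 1 := by
      rw [← Real.exp_add]
      simp
    have hN : (1 - 2 * M r / r) * (deriv ν r + deriv lam r)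
        = 4 * Real.pi * r * (p r + ε r) := by
      have : r - 2 * M r ≠ 0 := (sub_pos.2 (hMlt r hr)).ne'
      rw [hnu_lam r hr]
      field_simp
    have hhf : h r = r ^ 2 * (α - ω r) * f r := by
      have := hu r hr
      rw [hfdef r hr]
      field_simp
    have hK := hKojima r hr
    have hH := hhartle r hr
    rw [hWV]
    have hr0 := hr.ne'
    generalize deriv (fun s => Real.exp (-(ν s) - lam s) * deriv h s) r = A at *
    generalize Real.exp (lam r - ν r) = V at *
    generalize Real.exp (ν r - lam r) = E at *
    rw [hhf] at hK ⊢
    rw [show -(deriv ν r) - deriv lam r = -(deriv ν r + deriv lam r) by ring]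
    generalize deriv ν r + deriv lam r = N at *
    have hA : A * (α - ω r) = V * (((l : ℝ) * ((l : ℝ) + 1) / r ^ 2 - 4 * M r / r ^ 3
            + 8 * Real.pi * (p r + ε r)) * (α - ω r)
          - 16 * Real.pi * (p r + ε r) * α) * (r ^ 2 * (α - ω r) * f r) := by
      linear_combination V * hK - A * (α - ω r) * hVE
    have hH' : (1 - 2 * M r / r) * (r ^ 2 * deriv (deriv ω) r + 4 * r * deriv ω r)
        = 4 * Real.pi * r * (p r + ε r) * (r ^ 2 * deriv ω r + 4 * r * ω r) := by
      rw [← hN]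
      have : r ^ 2 * deriv (deriv ω) r + 4 * r * deriv ω r
          = N * (r ^ 2 * deriv ω r + 4 * r * ω r) := by
        field_simp at hH
        linear_combination r * hH
      rw [this]
      ring
    have hl_cancel : r ^ 2 * ((l : ℝ) * ((l : ℝ) + 1) / r ^ 2 - 4 * M r / r ^ 3)
        = (l : ℝ) * ((l : ℝ) + 1) - 2 + 2 * (1 - 2 * M r / r) := by
      field_simp
      ring
    generalize (l : ℝ) * ((l : ℝ) + 1) / r ^ 2 - 4 * M r / r ^ 3 = Q at *
    generalize 1 - 2 * M r / r = k at *
    linear_combination r ^ 2 * hA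
      + V * r ^ 2 * (α - ω r) ^ 2 * f r * hl_cancel
      + V * r ^ 2 * (α - ω r) * f r * (2 * r * (α - ω r) - r ^ 2 * deriv ω r) * hN
      + V * r ^ 2 * (α - ω r) * f r * hH'
  have hL : 0 < (l : ℝ) * ((l : ℝ) + 1) - 2 := by
    have : (2 : ℝ) ≤ l := by exact_mod_cast hl
    nlinarith
  have hf_zero : ∀ r > (0:ℝ), f r = 0 := by
    have hzero := deriv_eq_zero_of_nonneg_of_tendsto_zero
      (F := fun r => r ^ 4 * Real.exp (-(lam r) - ν r) * (α - ω r) ^ 2 * f r * deriv f r)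
      (D := fun r => (α - ω r) ^ 2 * ((l : ℝ) * ((l : ℝ) + 1) - 2) * r ^ 2
          * Real.exp (lam r - ν r) * f r ^ 2
        + (r ^ 2 * (α - ω r)) ^ 2 * Real.exp (-(ν r) - lam r) * deriv f r ^ 2)
      ?_ (fun r _ => by positivity) hbdry0 hbdryinf
    · intro r hr
      have hur := hu r hr
      have hpos : 0 < (α - ω r) ^ 2 * ((l : ℝ) * ((l : ℝ) + 1) - 2) * r ^ 2
          * Real.exp (lam r - ν r) := by positivity
      have hnn : 0 ≤ (r ^ 2 * (α - ω r)) ^ 2 * Real.exp (-(ν r) - lam r) * deriv f r ^ 2 := by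
        positivity
      have hz := hzero r hr
      have hfr : f r ^ 2 = 0 := by
        by_contra hne
        have := mul_pos hpos (lt_of_le_of_ne (sq_nonneg (f r)) (Ne.symm hne))
        linarith
      exact pow_eq_zero_iff two_ne_zero |>.1 hfr
    · intro r hr
      refine (((hflux r hr).fun_mul (hfC1 r hr).hasDerivAt).congr_of_eventuallyEq
        (.of_forall fun s => ?_)).congr_deriv (by ring)
      rw [neg_sub_comm]
      ring
  have hf'_zero : ∀ r > (0:ℝ), deriv f r = 0 := by
    intro r hr
    refine ((hasDerivAt_const r (0:ℝ)).congr_of_eventuallyEq ?_).deriv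
    filter_upwards [Ioi_mem_nhds hr] with s hs
    exact hf_zero s hs
  refine ⟨?_, hf_zero, ?_⟩
  · rw [setIntegral_eq_zero_of_forall_eq_zero, setIntegral_eq_zero_of_forall_eq_zero, neg_zero]
    · intro r hr
      simp [hf_zero r hr]
    · intro r hr
      simp [hf'_zero r hr]
  · intro r hr
    have hz := hf_zero r hr
    rw [hfdef r hr, div_eq_zero_iff] at hz
    exact hz.resolve_right (mul_ne_zero (pow_ne_zero 2 hr.ne') (hu r hr))
end

section
/- Let m ≥ 1 be an integer, R > 0 and h₀, h₁ be real numbers. Define h_in(r) = (r/R)^{m+1}·(h₀ + h₁·(r/R)²) and h_ex(r) = (h₀ + h₁)·(R/r)^m. Then h_in(R) = h_ex(R), and the Wronskian condition h_in(R)·h_ex'(R) − h_in'(R)·h_ex(R) = 0 holds if and only if (h₀ + h₁)·((2m+1)·h₀ + (2m+3)·h₁) = 0. In particular, if h₀ + h₁ ≠ 0 the matching conditions force (2m+1)h₀ + (2m+3)h₁ = 0. -/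
/-- Derivative at `r = R` of `(r/R)^n (a + b (r/R)²)`. -/
theorem hasDerivAt_div_pow_mul_quadratic (n : ℕ) {R : ℝ} (hR : R ≠ 0) (a b : ℝ) :
    HasDerivAt (fun r : ℝ => (r / R) ^ n * (a + b * (r / R) ^ 2))
      ((n * (a + b) + 2 * b) / R) R := by
  have h : HasDerivAt (fun r : ℝ => r / R) (1 / R) R := (hasDerivAt_id R).div_const R
  refine ((h.fun_pow n).fun_mul (((h.fun_pow 2).const_mul b).const_add a)).congr_deriv ?_
  simp only [div_self hR, one_pow]
  push_cast
  ring

/-- Derivative at `r = R` of `c (R/r)^n`. -/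
theorem hasDerivAt_const_mul_div_pow (n : ℕ) {R : ℝ} (hR : R ≠ 0) (c : ℝ) :
    HasDerivAt (fun r : ℝ => c * (R / r) ^ n) (-(n * c) / R) R := by
  have h : HasDerivAt (fun r : ℝ => R / r) (-1 / R) R := by
    refine ((hasDerivAt_inv hR).const_mul R).congr_deriv ?_
    field_simp
  refine ((h.fun_pow n).const_mul c).congr_deriv ?_
  simp only [div_self hR, one_pow]
  ring

/-- Matching the interior solution
`h_in(r) = (r/R)^{m+1}(h₀ + h₁(r/R)²)` to the exterior solution
`h_ex(r) = (h₀+h₁)(R/r)^m` at `r = R`: continuity holds automatically, and the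
Wronskian condition holds iff `(h₀+h₁)((2m+1)h₀ + (2m+3)h₁) = 0`; in particular if
`h₀ + h₁ ≠ 0` the matching forces `(2m+1)h₀ + (2m+3)h₁ = 0`. -/
theorem surface_matching_condition
    (m : ℕ) (hm : 1 ≤ m) (R h₀ h₁ : ℝ) (hR : 0 < R)
    (hin hex : ℝ → ℝ)
    (hindef : ∀ r : ℝ, hin r = (r / R) ^ (m + 1) * (h₀ + h₁ * (r / R) ^ 2))
    (hexdef : ∀ r : ℝ, hex r = (h₀ + h₁) * (R / r) ^ m) :
    hin R = hex R ∧
    (hin R * deriv hex R - deriv hin R * hex R = 0 ↔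
      (h₀ + h₁) * ((2 * (m : ℝ) + 1) * h₀ + (2 * (m : ℝ) + 3) * h₁) = 0) ∧
    (h₀ + h₁ ≠ 0 →
      hin R * deriv hex R - deriv hin R * hex R = 0 →
      (2 * (m : ℝ) + 1) * h₀ + (2 * (m : ℝ) + 3) * h₁ = 0) := by
  have hR0 : R ≠ 0 := hR.ne'
  have hin_R : hin R = h₀ + h₁ := by simp [hindef, div_self hR0]
  have hex_R : hex R = h₀ + h₁ := by simp [hexdef, div_self hR0]
  have hin_deriv : deriv hin R = ((m + 1) * (h₀ + h₁) + 2 * h₁) / R := by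
    rw [funext hindef, (hasDerivAt_div_pow_mul_quadratic (m + 1) hR0 h₀ h₁).deriv]
    push_cast
    rfl
  have hex_deriv : deriv hex R = -(m * (h₀ + h₁)) / R := by
    rw [funext hexdef, (hasDerivAt_const_mul_div_pow m hR0 (h₀ + h₁)).deriv]
  have wronskian : hin R * deriv hex R - deriv hin R * hex R =
      -((h₀ + h₁) * ((2 * (m : ℝ) + 1) * h₀ + (2 * (m : ℝ) + 3) * h₁)) / R := by
    rw [hin_R, hex_R, hin_deriv, hex_deriv]
    ring
  have wronskian_iff : hin R * deriv hex R - deriv hin R * hex R = 0 ↔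
      (h₀ + h₁) * ((2 * (m : ℝ) + 1) * h₀ + (2 * (m : ℝ) + 3) * h₁) = 0 := by
    rw [wronskian, div_eq_zero_iff, or_iff_left hR0, neg_eq_zero]
  exact ⟨hin_R.trans hex_R.symm, wronskian_iff,
    fun hne hw => (mul_eq_zero.mp (wronskian_iff.mp hw)).resolve_left hne⟩
end
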